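/- Smoothed lattice-point sandwich: let G be a unimodular locally compact second countable group with Haar measure m_G and Γ ≤ G a discrete subgroup. Let O_ε be a symmetric bounded neighborhood of the identity of positive measure, set χ_ε = 1_{O_ε}/m_G(O_ε), and let (G_t)_{t>0} be an increasing family of bounded Borel subsets such that for some c > 0, t₀ > 0: O_ε·G_t·O_ε ⊆ G_{t+cε} for all t ≥ t₀. Then for every h ∈ O_ε and every t with t − cε ≥ t₀: ∫_{G_{t−cε}} (Σ_{γ∈Γ} χ_ε(g⁻¹ h γ)) dm_G(g) ≤ |Γ ∩ G_t| ≤ ∫_{G_{t+cε}} (Σ_{γ∈Γ} χ_ε(g⁻¹ h γ)) dm_G(g). -/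

import Mathlib

open MeasureTheory Filter Set Pointwise
open scoped ENNReal NNReal

/-- A discrete subgroup of a (not necessarily Hausdorff) topological group meets every set with
compact closure in a finite set. -/
theorem Subgroup.finite_inter_of_isCompact_closure {G : Type*} [Group G] [TopologicalSpace G]
    [IsTopologicalGroup G] (Γ : Subgroup G) [DiscreteTopology Γ] {K : Set G}
    (hK : IsCompact (_root_.closure K)) : ((Γ : Set G) ∩ K).Finite := by
  obtain ⟨U, hU, hUΓ⟩ : ∃ U ∈ nhds (1 : G), ∀ γ ∈ Γ, γ ∈ U → γ = 1 := by
    have h1 : ({1} : Set Γ) ∈ nhds (1 : Γ) := by simp [nhds_discrete]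
    obtain ⟨U, hU, hsub⟩ := (mem_nhds_induced _ _ _).1 h1
    exact ⟨U, hU, fun γ hγ hγU =>
      congrArg Subtype.val (hsub (show (⟨γ, hγ⟩ : Γ) ∈ Subtype.val ⁻¹' U from hγU))⟩
  obtain ⟨V, hV, hVU⟩ := exists_nhds_split_inv hU
  obtain ⟨T, -, hT⟩ := hK.elim_nhds_subcover (fun g => {x | x⁻¹ * g ∈ V}) fun g _ => by
    have hc : Continuous fun x : G => x⁻¹ * g := by fun_prop
    exact hc.continuousAt.preimage_mem_nhds (by simpa using hV)
  refine (T.finite_toSet.biUnion (t := fun g => (Γ : Set G) ∩ {x | x⁻¹ * g ∈ V}) fun g _ =>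
    Set.Subsingleton.finite ?_).subset ?_
  · rintro x ⟨hxΓ, hx⟩ y ⟨hyΓ, hy⟩
    have hdiv := hVU _ hx _ hy
    have hxy : x⁻¹ * g / (y⁻¹ * g) = x⁻¹ * y := by simp [div_eq_mul_inv]
    rw [hxy] at hdiv
    exact (inv_mul_eq_one.1 (hUΓ _ (Γ.mul_mem (Γ.inv_mem hxΓ) hyΓ) hdiv))
  · rintro x ⟨hxΓ, hxK⟩
    obtain ⟨g, hg, hx⟩ := mem_iUnion₂.1 (hT (_root_.subset_closure hxK))
    exact mem_iUnion₂.2 ⟨g, hg, hxΓ, hx⟩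

/-- The number of points of a subgroup in a set, as a sum of indicators. -/
theorem Subgroup.tsum_indicator_eq_ncard {G : Type*} [Group G] (Γ : Subgroup G) {K : Set G}
    (hK : ((Γ : Set G) ∩ K).Finite) :
    ∑' γ : Γ, K.indicator (fun _ => (1 : ℝ≥0∞)) (γ : G) = ((Γ : Set G) ∩ K).ncard := by
  have himage : (Subtype.val '' ((↑) ⁻¹' K : Set Γ) : Set G) = (Γ : Set G) ∩ K :=
    Subtype.image_preimage_coe _ _
  calc ∑' γ : Γ, K.indicator (fun _ => (1 : ℝ≥0∞)) (γ : G)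
      = ∑' _ : ((↑) ⁻¹' K : Set Γ), (1 : ℝ≥0∞) :=
        (tsum_subtype (Subtype.val ⁻¹' K : Set Γ) fun _ => (1 : ℝ≥0∞)).symm
    _ = ((((↑) ⁻¹' K : Set Γ).encard : ℕ∞) : ℝ≥0∞) := ENNReal.tsum_set_one _
    _ = ((Γ : Set G) ∩ K).ncard := by
      rw [← Subtype.val_injective.encard_image, himage, ← hK.cast_ncard_eq]
      rfl

/-- For a symmetric set `O`, integrating the sum over `Γ` of the normalized indicators of the
translates `h γ O` over `A` gives the sum of the relative measures of `A ∩ h γ O`. -/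
theorem lintegral_tsum_indicator_inv_mul {G : Type*} [Group G]
    [MeasurableSpace G] [MeasurableMul G] (μ : Measure G)
    (Γ : Subgroup G) [Countable Γ] {O : Set G} (hO_symm : O⁻¹ = O) (hO_meas : MeasurableSet O)
    (h : G) (A : Set G) :
    ∫⁻ g in A, ∑' γ : Γ, O.indicator (fun _ => (μ O)⁻¹) (g⁻¹ * h * (γ : G)) ∂μ
      = ∑' γ : Γ, (μ O)⁻¹ * μ.restrict A ((fun g => (h * (γ : G))⁻¹ * g) ⁻¹' O) := by
  have hmeas (γ : Γ) : MeasurableSet ((fun g => (h * (γ : G))⁻¹ * g) ⁻¹' O) :=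
    measurable_const_mul _ hO_meas
  have hind (γ : Γ) (g : G) : O.indicator (fun _ => (μ O)⁻¹) (g⁻¹ * h * (γ : G))
      = ((fun g => (h * (γ : G))⁻¹ * g) ⁻¹' O).indicator (fun _ => (μ O)⁻¹) g := by
    have hiff : g⁻¹ * h * (γ : G) ∈ O ↔ g ∈ (fun g => (h * (γ : G))⁻¹ * g) ⁻¹' O := by
      rw [mem_preimage, ← Set.inv_mem_inv, hO_symm]
      simp [mul_assoc]
    by_cases hg : g⁻¹ * h * (γ : G) ∈ O
    · rw [indicator_of_mem hg, indicator_of_mem (hiff.1 hg)]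
    · rw [indicator_of_notMem hg, indicator_of_notMem (mt hiff.2 hg)]
  simp_rw [hind]
  rw [lintegral_tsum fun γ => (measurable_const.indicator (hmeas γ)).aemeasurable]
  simp_rw [lintegral_indicator_const (hmeas _)]

/-- **Smoothed lattice-point sandwich** (Gorodnik–Nevo, proof of Lemma 6.13).
Let `G` be a unimodular lcsc group with Haar measure `μ`, `Γ` a discrete subgroup, and
`O` a symmetric bounded neighborhood of the identity of positive measure, with normalized
indicator `χ = 1_O / μ(O)`. If `(B t)` is an increasing family of bounded Borel sets with
`O · B t · O ⊆ B (t + cε)` for all `t ≥ t₀`, then for every `h ∈ O` and every `t` with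
`t − cε ≥ t₀`,
`∫_{B (t−cε)} Σ_{γ∈Γ} χ(g⁻¹ h γ) dμ(g) ≤ |Γ ∩ B t| ≤ ∫_{B (t+cε)} Σ_{γ∈Γ} χ(g⁻¹ h γ) dμ(g)`. -/
theorem smoothed_lattice_point_sandwich
    {G : Type*} [Group G] [TopologicalSpace G] [IsTopologicalGroup G]
    [LocallyCompactSpace G] [SecondCountableTopology G]
    [MeasurableSpace G] [BorelSpace G]
    (μ : Measure G) [μ.IsHaarMeasure] [μ.IsMulRightInvariant]
    (Γ : Subgroup G) [DiscreteTopology Γ]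
    (ε : ℝ) (hε : 0 < ε)
    (O : Set G) (hO_nhds : O ∈ nhds (1 : G)) (hO_symm : O⁻¹ = O)
    (hO_bdd : IsCompact (closure O)) (hO_meas : MeasurableSet O) (hO_pos : 0 < μ O)
    (B : ℝ → Set G)
    (hmono : ∀ s t : ℝ, 0 < s → s ≤ t → B s ⊆ B t)
    (hbdd : ∀ t : ℝ, 0 < t → IsCompact (closure (B t)))
    (hmeas : ∀ t : ℝ, 0 < t → MeasurableSet (B t))
    (c t₀ : ℝ) (hc : 0 < c) (ht₀ : 0 < t₀)
    (hstable : ∀ t ≥ t₀, O * B t * O ⊆ B (t + c * ε))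
    (h : G) (hh : h ∈ O) (t : ℝ) (ht : t₀ ≤ t - c * ε) :
    (∫⁻ g in B (t - c * ε),
        ∑' γ : Γ, O.indicator (fun _ => (μ O)⁻¹) (g⁻¹ * h * (γ : G)) ∂μ)
      ≤ (((Γ : Set G) ∩ B t).ncard : ℝ≥0∞) ∧
    (((Γ : Set G) ∩ B t).ncard : ℝ≥0∞)
      ≤ ∫⁻ g in B (t + c * ε),
          ∑' γ : Γ, O.indicator (fun _ => (μ O)⁻¹) (g⁻¹ * h * (γ : G)) ∂μ := by
  have hO_inv {x : G} (hx : x ∈ O) : x⁻¹ ∈ O := by rwa [← Set.mem_inv, hO_symm]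
  have hcε : 0 < c * ε := mul_pos hc hε
  have hO_top : μ O ≠ ∞ := ((measure_mono subset_closure).trans_lt hO_bdd.measure_lt_top).ne
  have hO_one : (μ O)⁻¹ * μ O = 1 := ENNReal.inv_mul_cancel hO_pos.ne' hO_top
  have : Countable Γ := TopologicalSpace.separableSpace_iff_countable.1 inferInstance
  have hfin := Γ.finite_inter_of_isCompact_closure (hbdd t (by linarith))
  rw [lintegral_tsum_indicator_inv_mul μ Γ hO_symm hO_meas,
    lintegral_tsum_indicator_inv_mul μ Γ hO_symm hO_meas, ← Γ.tsum_indicator_eq_ncard hfin]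
  constructor <;> refine ENNReal.tsum_le_tsum fun γ => ?_
  · by_cases hγ : (γ : G) ∈ B t
    · rw [indicator_of_mem hγ, ← hO_one, ← measure_preimage_mul μ (h * (γ : G))⁻¹ O]
      gcongr
      exact Measure.restrict_le_self
    · rw [Measure.restrict_apply (measurable_const_mul _ hO_meas)]
      suffices hempty : (fun g => (h * (γ : G))⁻¹ * g) ⁻¹' O ∩ B (t - c * ε) = ∅ by
        rw [hempty, measure_empty, mul_zero]
        exact zero_le
      refine eq_empty_of_forall_notMem fun g ⟨hgO, hgB⟩ => hγ ?_
      have hmem := hstable _ ht (mul_mem_mul (mul_mem_mul (hO_inv hh) hgB) (hO_inv hgO))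
      have hprod : h⁻¹ * g * ((h * (γ : G))⁻¹ * g)⁻¹ = γ := by group
      rwa [hprod, sub_add_cancel] at hmem
  · by_cases hγ : (γ : G) ∈ B t
    · have hsub : (fun g => (h * (γ : G))⁻¹ * g) ⁻¹' O ⊆ B (t + c * ε) := fun g hg => by
        have hmem := hstable t (by linarith) (mul_mem_mul (mul_mem_mul hh hγ) hg)
        rwa [mul_inv_cancel_left] at hmem
      rw [indicator_of_mem hγ, Measure.restrict_eq_self μ hsub, measure_preimage_mul, hO_one]
    · simp [hγ]
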